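/- Let n ≥ 2 and let Σ be a symbolic collision sequence. If there exists a single admissible mass vector m⁰ (m⁰_1 > m⁰_2 > … > m⁰_n > 0) with N(Σ, m⁰) = {0}, then Σ is sufficient: there exists a nonzero polynomial P ∈ ℝ[x_1,…,x_n] such that N(Σ, m) = {0} for every admissible mass vector m with P(m) ≠ 0. -/

import Mathlib

open Matrix BigOperators

/-- `γ_i = (m_i - m_{i+1})/(m_i + m_{i+1})` (masses indexed 1-based). -/
noncomputable def gammaC (m : ℕ → ℝ) (i : ℕ) : ℝ := (m i - m (i + 1)) / (m i + m (i + 1))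

/-- `α_i(ρ) = 2 m_i m_{i+1} (m_i - m_{i+1}) ρ / (m_i + m_{i+1})²`. -/
noncomputable def alphaC (m : ℕ → ℝ) (i : ℕ) (ρ : ℝ) : ℝ :=
  2 * m i * m (i + 1) * (m i - m (i + 1)) * ρ / (m i + m (i + 1)) ^ 2

/-- The collision matrix `R_i` (1 ≤ i ≤ n-1); particles are 1-based, so particle `i`
has 0-based index `i - 1` (i.e. `a : Fin n` with `a + 1 = i`).  `R_0 = I`. -/
noncomputable def Rmat (n : ℕ) (m : ℕ → ℝ) (i : ℕ) : Matrix (Fin n) (Fin n) ℝ :=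
  if i = 0 then 1 else
    Matrix.of fun a b =>
      if (a : ℕ) + 1 = i ∧ (b : ℕ) + 1 = i then gammaC m i
      else if (a : ℕ) + 1 = i ∧ (b : ℕ) = i then 1 - gammaC m i
      else if (a : ℕ) = i ∧ (b : ℕ) + 1 = i then 1 + gammaC m i
      else if (a : ℕ) = i ∧ (b : ℕ) = i then -(gammaC m i)
      else if a = b then 1 else 0

/-- The matrix `S_i(ρ)` (zero unless 1 ≤ i ≤ n-1). -/
noncomputable def Smat (n : ℕ) (m : ℕ → ℝ) (i : ℕ) (ρ : ℝ) : Matrix (Fin n) (Fin n) ℝ :=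
  if i = 0 then 0 else
    Matrix.of fun a b =>
      if (a : ℕ) + 1 = i ∧ (b : ℕ) + 1 = i then alphaC m i ρ
      else if (a : ℕ) + 1 = i ∧ (b : ℕ) = i then -(alphaC m i ρ)
      else if (a : ℕ) = i ∧ (b : ℕ) + 1 = i then -(alphaC m i ρ)
      else if (a : ℕ) = i ∧ (b : ℕ) = i then alphaC m i ρ
      else 0

/-- The quadratic form `Q₁(δh, δv) = Σ_j δh_j δv_j`. -/
noncomputable def Qform (n : ℕ) (x : (Fin n → ℝ) × (Fin n → ℝ)) : ℝ :=
  ∑ j, x.1 j * x.2 j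

/-- The collision map `D_{(i,ρ)}`: floor collision when `i = 0`,
ball-to-ball collision `(i, i+1)` when `1 ≤ i ≤ n-1`. -/
noncomputable def Dmap (n : ℕ) (m : ℕ → ℝ) (i : ℕ) (ρ : ℝ)
    (x : (Fin n → ℝ) × (Fin n → ℝ)) : (Fin n → ℝ) × (Fin n → ℝ) :=
  if i = 0 then
    (x.1, fun j => x.2 j + if (j : ℕ) = 0 then 2 * x.1 j / (m 1 * ρ) else 0)
  else
    ((Rmat n m i)ᵀ *ᵥ (x.1 + Smat n m i ρ *ᵥ x.2), Rmat n m i *ᵥ x.2)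

/-- Composition `D_{(i_N,ρ_N)} ∘ ⋯ ∘ D_{(i_1,ρ_1)}` along an extended symbolic sequence,
given as the list `[(i_1,ρ_1), …, (i_N,ρ_N)]`. -/
noncomputable def Dcomp (n : ℕ) (m : ℕ → ℝ) :
    List (ℕ × ℝ) → ((Fin n → ℝ) × (Fin n → ℝ)) → ((Fin n → ℝ) × (Fin n → ℝ))
  | [], x => x
  | c :: rest, x => Dcomp n m rest (Dmap n m c.1 c.2 x)

/-- `Rprod [i_1, …, i_k] = R_{i_k}ᵀ ⋯ R_{i_2}ᵀ R_{i_1}ᵀ`. -/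
noncomputable def Rprod (n : ℕ) (m : ℕ → ℝ) : List ℕ → Matrix (Fin n) (Fin n) ℝ
  | [] => 1
  | i :: rest => Rprod n m rest * (Rmat n m i)ᵀ

/-- The neutral space `N(Σ, m)`: vectors `δh` with `Σ_j δh_j = 0` such that for every
prefix of `Σ` ending with a floor collision, the first entry of the corresponding
product `R_{i_k}ᵀ ⋯ R_{i_1}ᵀ δh` vanishes. -/
noncomputable def NeutralSpace (n : ℕ) (m : ℕ → ℝ) (Sl : List ℕ) : Set (Fin n → ℝ) :=
  {δh | (∑ j, δh j) = 0 ∧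
    ∀ p : List ℕ, p <+: Sl → p.getLast? = some 0 →
      ∀ a : Fin n, (a : ℕ) = 0 → (Rprod n m p *ᵥ δh) a = 0}

/-- An admissible mass vector: `m_1 > m_2 > … > m_n > 0` (1-based indexing). -/
def Admissible (n : ℕ) (m : ℕ → ℝ) : Prop :=
  (∀ i : ℕ, 1 ≤ i → i < n → m (i + 1) < m i) ∧ 0 < m n

/-- The functions of the mass vector that agree on admissible mass vectors with a quotient of
polynomials whose denominator vanishes at no admissible mass vector. -/
def regularFunctions (n : ℕ) : Subring ((ℕ → ℝ) → ℝ) where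
  carrier := {f | ∃ P Q : MvPolynomial (Fin n) ℝ, ∀ m, Admissible n m →
    MvPolynomial.eval (fun j : Fin n => m ((j : ℕ) + 1)) Q ≠ 0 ∧
      f m * MvPolynomial.eval (fun j : Fin n => m ((j : ℕ) + 1)) Q =
        MvPolynomial.eval (fun j : Fin n => m ((j : ℕ) + 1)) P}
  zero_mem' := ⟨0, 1, by simp⟩
  one_mem' := ⟨1, 1, by simp⟩
  neg_mem' := by
    rintro f ⟨P, Q, h⟩
    refine ⟨-P, Q, fun m hm => ⟨(h m hm).1, ?_⟩⟩
    simp [← (h m hm).2]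
  add_mem' := by
    rintro f g ⟨P, Q, h⟩ ⟨P', Q', h'⟩
    refine ⟨P * Q' + P' * Q, Q * Q', fun m hm => ⟨?_, ?_⟩⟩
    · simpa using ⟨(h m hm).1, (h' m hm).1⟩
    · simp only [map_mul, map_add, Pi.add_apply, ← (h m hm).2, ← (h' m hm).2]
      ring
  mul_mem' := by
    rintro f g ⟨P, Q, h⟩ ⟨P', Q', h'⟩
    refine ⟨P * P', Q * Q', fun m hm => ⟨?_, ?_⟩⟩
    · simpa using ⟨(h m hm).1, (h' m hm).1⟩
    · simp only [map_mul, Pi.mul_apply, ← (h m hm).2, ← (h' m hm).2]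
      ring

/-- All masses of an admissible mass vector are positive. -/
theorem Admissible.pos {n : ℕ} {m : ℕ → ℝ} (hm : Admissible n m) {i : ℕ} (hi : 1 ≤ i)
    (hin : i ≤ n) : 0 < m i := by
  induction hin using Nat.decreasingInduction with
  | self => exact hm.2
  | of_succ k hk ih => exact (ih (by omega)).trans (hm.1 k hi hk)

theorem gammaC_mem_regularFunctions {n i : ℕ} (hi : 1 ≤ i) (hin : i < n) :
    (fun m => gammaC m i) ∈ regularFunctions n := by
  refine ⟨.X ⟨i - 1, by omega⟩ - .X ⟨i, hin⟩, .X ⟨i - 1, by omega⟩ + .X ⟨i, hin⟩,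
    fun m hm => ?_⟩
  have h : m i + m (i + 1) ≠ 0 :=
    (add_pos (hm.pos hi hin.le) (hm.pos (by omega) hin)).ne'
  simp only [map_add, map_sub, MvPolynomial.eval_X, Nat.sub_add_cancel hi, gammaC]
  exact ⟨h, div_mul_cancel₀ _ h⟩

theorem Rmat_mem_regularFunctions {n i : ℕ} (hn : 1 ≤ n) (hi : i ≤ n - 1) (a b : Fin n) :
    (fun m => Rmat n m i a b) ∈ regularFunctions n := by
  have hone : (fun _ => (1 : ℝ)) ∈ regularFunctions n := one_mem _
  have hzero : (fun _ => (0 : ℝ)) ∈ regularFunctions n := zero_mem _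
  by_cases h0 : i = 0
  · simp only [Rmat, h0, if_true, Matrix.one_apply]
    split_ifs <;> assumption
  · have hγ := gammaC_mem_regularFunctions (n := n) (i := i) (by omega) (by omega)
    simp only [Rmat, h0, if_false, Matrix.of_apply]
    split_ifs
    exacts [hγ, sub_mem hone hγ, add_mem hone hγ, neg_mem hγ, hone, hzero]

theorem Matrix.mul_mem_regularFunctions {n : ℕ} {l p q : Type*} [Fintype p]
    {A : (ℕ → ℝ) → Matrix l p ℝ} {B : (ℕ → ℝ) → Matrix p q ℝ}
    (hA : ∀ a b, (fun m => A m a b) ∈ regularFunctions n)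
    (hB : ∀ a b, (fun m => B m a b) ∈ regularFunctions n) (a : l) (b : q) :
    (fun m => (A m * B m) a b) ∈ regularFunctions n := by
  have h := sum_mem (t := Finset.univ) fun c _ => mul_mem (hA a c) (hB c b)
  convert h using 1
  ext m
  simp [Matrix.mul_apply]

theorem Matrix.det_mem_regularFunctions {n : ℕ} {p : Type*} [Fintype p] [DecidableEq p]
    {A : (ℕ → ℝ) → Matrix p p ℝ} (hA : ∀ a b, (fun m => A m a b) ∈ regularFunctions n) :
    (fun m => (A m).det) ∈ regularFunctions n := by
  have h := sum_mem (t := Finset.univ) fun (σ : Equiv.Perm p) _ =>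
    zsmul_mem (prod_mem (t := Finset.univ) fun c _ => hA (σ c) c) (Equiv.Perm.sign σ : ℤ)
  convert h using 1
  ext m
  simp [Matrix.det_apply']

theorem Rprod_mem_regularFunctions {n : ℕ} (hn : 1 ≤ n) {p : List ℕ}
    (hp : ∀ i ∈ p, i ≤ n - 1) (a b : Fin n) :
    (fun m => Rprod n m p a b) ∈ regularFunctions n := by
  induction p generalizing a b with
  | nil =>
    have hone : (fun _ => (1 : ℝ)) ∈ regularFunctions n := one_mem _
    have hzero : (fun _ => (0 : ℝ)) ∈ regularFunctions n := zero_mem _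
    simp only [Rprod, Matrix.one_apply]
    split_ifs <;> assumption
  | cons i p ih =>
    exact Matrix.mul_mem_regularFunctions (ih fun j hj => hp j (by simp [hj]))
      (fun a b => Rmat_mem_regularFunctions hn (hp i (by simp)) b a) a b

/-- A matrix whose kernel is the neutral space: one row of ones, and one row for each prefix
of the sequence, which is zero unless the prefix ends with a floor collision. -/
noncomputable def neutralMatrix (n : ℕ) [NeZero n] (Sl : List ℕ) (m : ℕ → ℝ) :
    Matrix (Option (Fin (Sl.length + 1))) (Fin n) ℝ :=
  Matrix.of fun r b => r.elim 1 fun k =>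
    if (Sl.take k).getLast? = some 0 then Rprod n m (Sl.take k) 0 b else 0

theorem mem_neutralSpace_iff {n : ℕ} [NeZero n] {Sl : List ℕ} {m : ℕ → ℝ} {x : Fin n → ℝ} :
    x ∈ NeutralSpace n m Sl ↔ neutralMatrix n Sl m *ᵥ x = 0 := by
  constructor
  · rintro ⟨hsum, h⟩
    ext (_ | k)
    · simpa [neutralMatrix, Matrix.mulVec, dotProduct] using hsum
    · by_cases hk : (Sl.take k).getLast? = some 0
      · simpa [neutralMatrix, Matrix.mulVec, dotProduct, hk] using
          h _ (List.take_prefix _ _) hk 0 rfl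
      · simp [neutralMatrix, Matrix.mulVec, dotProduct, hk]
  · intro h
    refine ⟨by simpa [neutralMatrix, Matrix.mulVec, dotProduct] using congrFun h none, ?_⟩
    intro p hp hlast a ha
    obtain rfl : a = 0 := Fin.ext ha
    have hpt := List.prefix_iff_eq_take.1 hp
    rw [hpt] at hlast ⊢
    simpa [neutralMatrix, Matrix.mulVec, dotProduct, hlast] using
      congrFun h (some ⟨p.length, Nat.lt_succ_of_le hp.length_le⟩)

theorem neutralSpace_eq_zero_iff {n : ℕ} [NeZero n] {Sl : List ℕ} {m : ℕ → ℝ} :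
    NeutralSpace n m Sl = {0} ↔ ((neutralMatrix n Sl m)ᵀ * neutralMatrix n Sl m).det ≠ 0 := by
  rw [Ne, ← Matrix.exists_mulVec_eq_zero_iff, ← Matrix.conjTranspose_eq_transpose_of_trivial]
  simp only [Matrix.conjTranspose_mul_self_mulVec_eq_zero, ← mem_neutralSpace_iff]
  have h0 : (0 : Fin n → ℝ) ∈ NeutralSpace n m Sl := mem_neutralSpace_iff.2 (by simp)
  rw [Set.eq_singleton_iff_unique_mem]
  push Not
  exact ⟨fun h x hx hmem => hx (h.2 x hmem),
    fun h => ⟨h0, fun x hmem => by_contra fun hx => h x hx hmem⟩⟩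

theorem neutralMatrix_mem_regularFunctions {n : ℕ} [NeZero n] {Sl : List ℕ}
    (hS : ∀ i ∈ Sl, i ≤ n - 1) (r : Option (Fin (Sl.length + 1))) (b : Fin n) :
    (fun m => neutralMatrix n Sl m r b) ∈ regularFunctions n := by
  obtain _ | k := r
  · exact one_mem (regularFunctions n)
  · simp only [neutralMatrix, Matrix.of_apply, Option.elim_some]
    split_ifs
    · exact Rprod_mem_regularFunctions NeZero.one_le
        (fun i hi => hS i (List.mem_of_mem_take hi)) _ _
    · exact zero_mem (regularFunctions n)

/-- If the neutral space is trivial for a single admissible mass vector,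
then the symbolic sequence is sufficient (trivial neutral space for almost every mass
vector, off the zero set of a nonzero polynomial). -/
theorem sufficiency_from_one_mass_vector (n : ℕ) (hn : 2 ≤ n)
    (Sl : List ℕ) (hS : ∀ i ∈ Sl, i ≤ n - 1)
    (h : ∃ m₀ : ℕ → ℝ, Admissible n m₀ ∧ NeutralSpace n m₀ Sl = {0}) :
    ∃ P : MvPolynomial (Fin n) ℝ, P ≠ 0 ∧
      ∀ m : ℕ → ℝ, Admissible n m →
        MvPolynomial.eval (fun j : Fin n => m ((j : ℕ) + 1)) P ≠ 0 →
          NeutralSpace n m Sl = {0} := by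
  have : NeZero n := ⟨by omega⟩
  have hA := neutralMatrix_mem_regularFunctions hS
  obtain ⟨P, Q, hPQ⟩ := Matrix.det_mem_regularFunctions
    (Matrix.mul_mem_regularFunctions (A := fun m => (neutralMatrix n Sl m)ᵀ)
      (fun a b => hA b a) hA)
  have key : ∀ m, Admissible n m → (NeutralSpace n m Sl = {0} ↔
      MvPolynomial.eval (fun j : Fin n => m ((j : ℕ) + 1)) P ≠ 0) := fun m hm => by
    rw [neutralSpace_eq_zero_iff, ← (hPQ m hm).2, mul_ne_zero_iff, and_iff_left (hPQ m hm).1]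
  obtain ⟨m₀, hm₀, h₀⟩ := h
  refine ⟨P, ?_, fun m hm => (key m hm).2⟩
  rintro rfl
  exact (key m₀ hm₀).1 h₀ (map_zero _)
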